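/- Let p ≥ 1 with Hölder conjugate p* (1/p + 1/p* = 1, with p* = ∞ and d^{1/p*} := 1 when p = 1), let W > 0, ε ≥ 0, ρ > 0 and x ∈ ℝ^d. For w, w' ∈ ℝ^d define ψ(w, w') := min_{‖δ‖_∞ ≤ ε} [ ⟨w, δ⟩⟨w', δ⟩ + ⟨w, x⟩⟨w', δ⟩ + ⟨w', x⟩⟨w, δ⟩ ]. If w, w', w_c, w_c' ∈ ℝ^d satisfy ‖w‖_p, ‖w'‖_p, ‖w_c‖_p, ‖w_c'‖_p ≤ W, ‖w − w_c‖_p ≤ ρ and ‖w' − w_c'‖_p ≤ ρ, then | ψ(w, w') − ψ(w_c, w_c') | ≤ 2 ρ ε d^{1/p*} W ( ε d^{1/p*} + 2 ‖x‖_{p*} ). -/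

import Mathlib

open scoped BigOperators

noncomputable def supNorm {d : ℕ} (v : Fin d → ℝ) : ℝ := ⨆ i, |v i|

noncomputable def pNorm {d : ℕ} (p : ℝ) (v : Fin d → ℝ) : ℝ := (∑ i, |v i| ^ p) ^ (1 / p)

noncomputable def twoNorm {d : ℕ} (v : Fin d → ℝ) : ℝ := Real.sqrt (∑ i, (v i) ^ 2)

def ip {d : ℕ} (w x : Fin d → ℝ) : ℝ := ∑ i, w i * x i

noncomputable def outer {d : ℕ} (v : Fin d → ℝ) : Matrix (Fin d) (Fin d) ℝ :=
  Matrix.of fun a b => v a * v b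

noncomputable def specNorm {d : ℕ} (A : Matrix (Fin d) (Fin d) ℝ) : ℝ :=
  sSup {y : ℝ | ∃ v : Fin d → ℝ, twoNorm v ≤ 1 ∧ y = twoNorm (A.mulVec v)}

noncomputable def Esign (n : ℕ) (f : (Fin n → ℝ) → ℝ) : ℝ :=
  (∑ s : Fin n → Bool, f fun i => if s i then (1 : ℝ) else -1) / 2 ^ n

noncomputable def dualN {d : ℕ} (p : ℝ) (x : Fin d → ℝ) : ℝ :=
  if p = 1 then supNorm x else pNorm (p / (p - 1)) x

lemma le_supN {d : ℕ} (x : Fin d → ℝ) (i : Fin d) : |x i| ≤ supNorm x :=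
  le_ciSup (f := fun i => |x i|) (Set.finite_range _).bddAbove i

lemma supN_nonneg {d : ℕ} (x : Fin d → ℝ) : 0 ≤ supNorm x :=
  Real.iSup_nonneg fun _ => abs_nonneg _

lemma pN_nonneg {d : ℕ} (p : ℝ) (x : Fin d → ℝ) : 0 ≤ pNorm p x :=
  Real.rpow_nonneg (Finset.sum_nonneg fun _ _ => Real.rpow_nonneg (abs_nonneg _) _) _

lemma dualN_nonneg {d : ℕ} (p : ℝ) (x : Fin d → ℝ) : 0 ≤ dualN p x := by
  unfold dualN
  split_ifs
  · exact supN_nonneg x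
  · exact pN_nonneg _ x

lemma holder {d : ℕ} (p : ℝ) (hp : 1 ≤ p) (w x : Fin d → ℝ) :
    |ip w x| ≤ pNorm p w * dualN p x := by
  unfold dualN
  split_ifs with h
  · subst h
    simp only [pNorm, ip, Real.rpow_one, div_one]
    refine (Finset.abs_sum_le_sum_abs _ _).trans ?_
    rw [Finset.sum_mul]
    refine Finset.sum_le_sum fun i _ => ?_
    rw [abs_mul]
    exact mul_le_mul_of_nonneg_left (le_supN x i) (abs_nonneg _)
  · have h1 : 1 < p := lt_of_le_of_ne hp (Ne.symm h)
    have hc : p.HolderConjugate (p / (p - 1)) := Real.HolderConjugate.conjExponent h1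
    refine (Finset.abs_sum_le_sum_abs _ _).trans ?_
    have := Real.inner_le_Lp_mul_Lq Finset.univ (fun i => |w i|) (fun i => |x i|) hc
    simpa only [abs_abs, abs_mul, pNorm] using this

lemma dualN_le {d : ℕ} (p ε : ℝ) (hp : 1 ≤ p) (hε : 0 ≤ ε) (x : Fin d → ℝ)
    (hx : supNorm x ≤ ε) : dualN p x ≤ ε * (d : ℝ) ^ (1 - 1 / p) := by
  unfold dualN
  split_ifs with h
  · subst h
    simpa using hx
  · have h1 : 1 < p := lt_of_le_of_ne hp (Ne.symm h)
    have hq : 0 < p / (p - 1) := div_pos (by linarith) (by linarith)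
    have e : 1 - 1 / p = 1 / (p / (p - 1)) := by
      have : p - 1 ≠ 0 := by linarith
      field_simp
    rw [e]
    generalize p / (p - 1) = q at hq
    unfold pNorm
    have : ∑ i, |x i| ^ q ≤ (d : ℝ) * ε ^ q := by
      have := Finset.sum_le_card_nsmul Finset.univ (fun i => |x i| ^ q) (ε ^ q)
        (fun i _ => Real.rpow_le_rpow (abs_nonneg _) ((le_supN x i).trans hx) hq.le)
      simpa using this
    refine (Real.rpow_le_rpow (Finset.sum_nonneg fun _ _ => Real.rpow_nonneg (abs_nonneg _) _)
      this (by positivity)).trans ?_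
    rw [Real.mul_rpow (by positivity) (by positivity), ← Real.rpow_mul hε,
      mul_one_div_cancel hq.ne', Real.rpow_one, mul_comm]

lemma sInf_aux {α : Type*} (P : α → Prop) (f g : α → ℝ) (C B : ℝ) (a : α) (ha : P a)
    (hB : ∀ δ, P δ → B ≤ f δ) (h : ∀ δ, P δ → f δ - g δ ≤ C) :
    sInf {t : ℝ | ∃ δ, P δ ∧ t = f δ} - sInf {t : ℝ | ∃ δ, P δ ∧ t = g δ} ≤ C := by
  have : sInf {t : ℝ | ∃ δ, P δ ∧ t = f δ} - C ≤ sInf {t : ℝ | ∃ δ, P δ ∧ t = g δ} := by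
    refine le_csInf ⟨g a, a, ha, rfl⟩ ?_
    rintro _ ⟨δ, hδ, rfl⟩
    have h1 : sInf {t : ℝ | ∃ δ, P δ ∧ t = f δ} ≤ f δ :=
      csInf_le ⟨B, by rintro _ ⟨δ, hδ, rfl⟩; exact hB δ hδ⟩ ⟨δ, hδ, rfl⟩
    linarith [h δ hδ]
  linarith

lemma prod_diff (a b a' b' R S U V : ℝ) (hU : |a - a'| ≤ R * U)
    (ha : |a'| ≤ S * U) (hb : |b| ≤ S * V) (hV : |b - b'| ≤ R * V) :
    |a * b - a' * b'| ≤ 2 * R * S * U * V := by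
  have e : a * b - a' * b' = (a - a') * b + a' * (b - b') := by ring
  rw [e]
  refine (abs_add_le _ _).trans ?_
  rw [abs_mul, abs_mul]
  have h1 := mul_le_mul hU hb (abs_nonneg _) ((abs_nonneg _).trans hU)
  have h2 := mul_le_mul ha hV (abs_nonneg _) ((abs_nonneg _).trans ha)
  linarith

lemma ip_sub' {d : ℕ} (w v x : Fin d → ℝ) : ip w x - ip v x = ip (w - v) x := by
  simp [ip, sub_mul]

lemma main_diff {d : ℕ} (p W ε ρ : ℝ) (hp : 1 ≤ p) (hW : 0 ≤ W) (hε : 0 ≤ ε)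
    (hρ : 0 ≤ ρ) (x : Fin d → ℝ)
    (w w' wc wc' : Fin d → ℝ)
    (hw : pNorm p w ≤ W) (hw' : pNorm p w' ≤ W)
    (hwc : pNorm p wc ≤ W) (hwc' : pNorm p wc' ≤ W)
    (hclose : pNorm p (w - wc) ≤ ρ) (hclose' : pNorm p (w' - wc') ≤ ρ)
    (δ : Fin d → ℝ) (hδ : supNorm δ ≤ ε) :
    |(ip w δ * ip w' δ + ip w x * ip w' δ + ip w' x * ip w δ) -
      (ip wc δ * ip wc' δ + ip wc x * ip wc' δ + ip wc' x * ip wc δ)| ≤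
      2 * ρ * ε * ((d : ℝ) ^ (1 - 1 / p)) * W *
        (ε * ((d : ℝ) ^ (1 - 1 / p)) + 2 * dualN p x) := by
  have hd := dualN_le p ε hp hε δ hδ
  set E := ε * (d : ℝ) ^ (1 - 1 / p) with hE
  have kx : ∀ (v : Fin d → ℝ) (A : ℝ), pNorm p v ≤ A → |ip v x| ≤ A * dualN p x :=
    fun v A hv => (holder p hp v x).trans (mul_le_mul_of_nonneg_right hv (dualN_nonneg p x))
  have kd : ∀ (v : Fin d → ℝ) (A : ℝ), pNorm p v ≤ A → |ip v δ| ≤ A * E :=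
    fun v A hv => (holder p hp v δ).trans
      (mul_le_mul hv hd (dualN_nonneg p δ) ((pN_nonneg p v).trans hv))
  have h1 := prod_diff (ip w δ) (ip w' δ) (ip wc δ) (ip wc' δ) ρ W E E
    (by rw [ip_sub']; exact kd _ _ hclose) (kd _ _ hwc) (kd _ _ hw')
    (by rw [ip_sub']; exact kd _ _ hclose')
  have h2 := prod_diff (ip w x) (ip w' δ) (ip wc x) (ip wc' δ) ρ W (dualN p x) E
    (by rw [ip_sub']; exact kx _ _ hclose) (kx _ _ hwc) (kd _ _ hw')
    (by rw [ip_sub']; exact kd _ _ hclose')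
  have h3 := prod_diff (ip w' x) (ip w δ) (ip wc' x) (ip wc δ) ρ W (dualN p x) E
    (by rw [ip_sub']; exact kx _ _ hclose') (kx _ _ hwc') (kd _ _ hw)
    (by rw [ip_sub']; exact kd _ _ hclose)
  have e : 2 * ρ * ε * ((d : ℝ) ^ (1 - 1 / p)) * W * (E + 2 * dualN p x) =
    2 * ρ * W * E * E + 2 * ρ * W * dualN p x * E + 2 * ρ * W * dualN p x * E := by
    rw [hE]; ring
  rw [e]
  rw [abs_le] at *
  constructor <;> linarith [h1.1, h1.2, h2.1, h2.2, h3.1, h3.2]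

theorem stmt19 {d : ℕ} (p W ε ρ : ℝ) (hp : 1 ≤ p) (hW : 0 < W) (hε : 0 ≤ ε)
    (hρ : 0 < ρ) (x : Fin d → ℝ)
    (w w' wc wc' : Fin d → ℝ)
    (hw : pNorm p w ≤ W) (hw' : pNorm p w' ≤ W)
    (hwc : pNorm p wc ≤ W) (hwc' : pNorm p wc' ≤ W)
    (hclose : pNorm p (w - wc) ≤ ρ) (hclose' : pNorm p (w' - wc') ≤ ρ) :
    |sInf {t : ℝ | ∃ δ : Fin d → ℝ, supNorm δ ≤ ε ∧
        t = ip w δ * ip w' δ + ip w x * ip w' δ + ip w' x * ip w δ} -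
      sInf {t : ℝ | ∃ δ : Fin d → ℝ, supNorm δ ≤ ε ∧
        t = ip wc δ * ip wc' δ + ip wc x * ip wc' δ + ip wc' x * ip wc δ}| ≤
      2 * ρ * ε * ((d : ℝ) ^ (1 - 1 / p)) * W *
        (ε * ((d : ℝ) ^ (1 - 1 / p)) +
          2 * (if p = 1 then supNorm x else pNorm (p / (p - 1)) x)) := by
  have hz : pNorm p (0 : Fin d → ℝ) = 0 := by
    have : p ≠ 0 := by linarith
    simp [pNorm, Real.zero_rpow this, Real.zero_rpow (inv_ne_zero this)]
  have h0 : supNorm (0 : Fin d → ℝ) ≤ ε := by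
    simpa [supNorm] using hε
  have lb : ∀ v v' : Fin d → ℝ, pNorm p v ≤ W → pNorm p v' ≤ W → ∀ δ, supNorm δ ≤ ε →
      -(2 * W * ε * ((d : ℝ) ^ (1 - 1 / p)) * W *
        (ε * ((d : ℝ) ^ (1 - 1 / p)) + 2 * dualN p x)) ≤
      ip v δ * ip v' δ + ip v x * ip v' δ + ip v' x * ip v δ := by
    intro v v' hv hv' δ hδ
    have := main_diff p W ε W hp hW.le hε hW.le x v v' 0 0 hv hv' (by rw [hz]; exact hW.le)
      (by rw [hz]; exact hW.le) (by simpa using hv) (by simpa using hv') δ hδ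
    have h2 := (abs_le.1 this).1
    simpa [ip] using h2
  have key := main_diff p W ε ρ hp hW.le hε hρ.le x w w' wc wc' hw hw' hwc hwc' hclose hclose'
  change _ ≤ 2 * ρ * ε * ((d : ℝ) ^ (1 - 1 / p)) * W *
        (ε * ((d : ℝ) ^ (1 - 1 / p)) + 2 * dualN p x)
  rw [abs_sub_le_iff]
  constructor
  · exact sInf_aux (fun δ => supNorm δ ≤ ε) _ _ _ _ 0 h0 (lb w w' hw hw')
      (fun δ hδ => (abs_sub_le_iff.1 (key δ hδ)).1)
  · exact sInf_aux (fun δ => supNorm δ ≤ ε) _ _ _ _ 0 h0 (lb wc wc' hwc hwc')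
      (fun δ hδ => (abs_sub_le_iff.1 (key δ hδ)).2)
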